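/- Let d ∈ ℕ, d ≥ 2, m > 0, γ ∈ (0, 1/2), let f, g ∈ 𝒮(ℝ^d, ℂ), let Λ be a real d × d matrix with ΛᵀẼΛ = Ẽ, det Λ = 1 and Λ₀₀ > 0, and let a ∈ ℝ^d. Write J h := 𝓕⁻¹(j·𝓕h), and let f_{a,Λ}(y) := f(a + Λy), g_{a,Λ}(y) := g(a + Λy). Then ∫_{ℝ^d} |(J f_{a,Λ})(x) + conj((J g_{a,Λ})(x))|² dx = ∫_{ℝ^d} |(J f)(x) + conj((J g)(x))|² dx. -/

import Mathlib

open MeasureTheory FourierTransform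

/-- The symbol `j(τ,ξ) = (τ² − (|ξ|² + m²))^(−γ)` on the forward mass region,
`0` elsewhere, on `ℝ^d ≅ ℝ × ℝ^{d−1}` (coordinate `0` is `τ`). -/
noncomputable def jmass (d : ℕ) [NeZero d] (m γ : ℝ)
    (x : EuclideanSpace ℝ (Fin d)) : ℝ :=
  if Real.sqrt ((∑ i ∈ Finset.univ.erase 0, x i ^ 2) + m ^ 2) < x 0 then
    (x 0 ^ 2 - ((∑ i ∈ Finset.univ.erase 0, x i ^ 2) + m ^ 2)) ^ (-γ)
  else 0

/-- The Minkowski metric matrix `Ẽ = diag(1, −1, …, −1)`. -/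
def minkMatrix (d : ℕ) [NeZero d] : Matrix (Fin d) (Fin d) ℝ :=
  Matrix.diagonal fun i => if i = 0 then 1 else -1

/-- Action of a `d × d` real matrix on `ℝ^d`. -/
noncomputable def matAct (d : ℕ) (Λ : Matrix (Fin d) (Fin d) ℝ)
    (x : EuclideanSpace ℝ (Fin d)) : EuclideanSpace ℝ (Fin d) :=
  (EuclideanSpace.equiv (Fin d) ℝ).symm (Λ.mulVec (EuclideanSpace.equiv (Fin d) ℝ x))

/-- The operator `J h = 𝓕⁻¹(j · 𝓕 h)`. -/
noncomputable def Jop (d : ℕ) [NeZero d] (m γ : ℝ)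
    (h : EuclideanSpace ℝ (Fin d) → ℂ) : EuclideanSpace ℝ (Fin d) → ℂ :=
  𝓕⁻ (fun ξ => (jmass d m γ ξ : ℂ) * 𝓕 h ξ)

open scoped Matrix

/-- The Minkowski quadratic form `x₀² − ∑_{i ≠ 0} xᵢ²`. -/
def minkForm (d : ℕ) [NeZero d] (v : Fin d → ℝ) : ℝ :=
  v 0 ^ 2 - ∑ i ∈ Finset.univ.erase 0, v i ^ 2

lemma dotProduct_minkMatrix_mulVec (d : ℕ) [NeZero d] (v : Fin d → ℝ) :
    v ⬝ᵥ (minkMatrix d *ᵥ v) = minkForm d v := by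
  simp only [minkForm, minkMatrix, dotProduct, Matrix.mulVec_diagonal]
  rw [← Finset.add_sum_erase _ _ (Finset.mem_univ (0 : Fin d)), sub_eq_add_neg,
    ← Finset.sum_neg_distrib]
  congr 1
  · simp [sq]
  · refine Finset.sum_congr rfl fun i hi => ?_
    rw [if_neg (Finset.ne_of_mem_erase hi)]
    ring

lemma minkMatrix_mul_self (d : ℕ) [NeZero d] : minkMatrix d * minkMatrix d = 1 := by
  rw [minkMatrix, Matrix.diagonal_mul_diagonal, ← Matrix.diagonal_one]
  congr 1
  ext i
  split_ifs <;> simp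

lemma minkMatrix_transpose (d : ℕ) [NeZero d] : (minkMatrix d)ᵀ = minkMatrix d :=
  Matrix.diagonal_transpose _

lemma minkMatrix_conj_transpose {d : ℕ} [NeZero d] {A : Matrix (Fin d) (Fin d) ℝ}
    (hA : Aᵀ * minkMatrix d * A = minkMatrix d) :
    A * minkMatrix d * Aᵀ = minkMatrix d := by
  have h1 : (minkMatrix d * Aᵀ * minkMatrix d) * A = 1 := by
    rw [mul_assoc, mul_assoc, ← mul_assoc Aᵀ, hA, minkMatrix_mul_self]
  have h2 : A * (minkMatrix d * Aᵀ * minkMatrix d) = 1 := mul_eq_one_comm.mp h1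
  calc A * minkMatrix d * Aᵀ
      = A * (minkMatrix d * Aᵀ * minkMatrix d) * minkMatrix d := by
        simp only [mul_assoc, minkMatrix_mul_self, mul_one]
    _ = minkMatrix d := by rw [h2, one_mul]

lemma minkForm_mulVec {d : ℕ} [NeZero d] {A : Matrix (Fin d) (Fin d) ℝ}
    (hA : Aᵀ * minkMatrix d * A = minkMatrix d) (v : Fin d → ℝ) :
    minkForm d (A *ᵥ v) = minkForm d v := by
  rw [← dotProduct_minkMatrix_mulVec, ← dotProduct_minkMatrix_mulVec]
  conv_rhs => rw [← hA]
  rw [← Matrix.mulVec_mulVec, ← Matrix.mulVec_mulVec, Matrix.dotProduct_mulVec v,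
    Matrix.vecMul_transpose]

lemma minkForm_row_zero {d : ℕ} [NeZero d] {A : Matrix (Fin d) (Fin d) ℝ}
    (hA : A * minkMatrix d * Aᵀ = minkMatrix d) : minkForm d (A 0) = 1 := by
  have h := congrFun (congrFun hA 0) 0
  rw [mul_assoc, Matrix.mul_apply_eq_vecMul] at h
  rw [← dotProduct_minkMatrix_mulVec]
  have h00 : minkMatrix d 0 0 = 1 := by simp [minkMatrix]
  rw [h00] at h
  rw [← h, ← Matrix.mulVec_transpose, Matrix.transpose_mul, Matrix.transpose_transpose,
    minkMatrix_transpose, ← Matrix.mulVec_mulVec]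
  rfl

/-- Two forward timelike vectors have positive Euclidean scalar product. -/
lemma dotProduct_pos_of_minkForm_pos {d : ℕ} [NeZero d] {u v : Fin d → ℝ}
    (hu : 0 < minkForm d u) (hv : 0 < minkForm d v) (hu0 : 0 < u 0) (hv0 : 0 < v 0) :
    0 < u ⬝ᵥ v := by
  have hcs := Finset.sum_mul_sq_le_sq_mul_sq (Finset.univ.erase (0 : Fin d)) u v
  rw [dotProduct, ← Finset.add_sum_erase _ _ (Finset.mem_univ (0 : Fin d))]
  simp only [minkForm] at hu hv
  have hU : 0 ≤ ∑ i ∈ Finset.univ.erase (0 : Fin d), u i ^ 2 :=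
    Finset.sum_nonneg fun i _ => sq_nonneg _
  have hV : 0 ≤ ∑ i ∈ Finset.univ.erase (0 : Fin d), v i ^ 2 :=
    Finset.sum_nonneg fun i _ => sq_nonneg _
  have hlt : (∑ i ∈ Finset.univ.erase (0 : Fin d), u i * v i) ^ 2 < (u 0 * v 0) ^ 2 := by
    refine hcs.trans_lt ?_
    rw [mul_pow]
    exact mul_lt_mul'' (by linarith) (by linarith) hU hV
  have := (abs_lt.mp (abs_lt_of_sq_lt_sq hlt (by positivity))).1
  linarith

lemma mulVec_zero_pos {d : ℕ} [NeZero d] {A : Matrix (Fin d) (Fin d) ℝ}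
    (hA : Aᵀ * minkMatrix d * A = minkMatrix d) (hA0 : 0 < A 0 0) {v : Fin d → ℝ}
    (hv : 0 < minkForm d v) (hv0 : 0 < v 0) : 0 < (A *ᵥ v) 0 :=
  dotProduct_pos_of_minkForm_pos
    (by rw [minkForm_row_zero (minkMatrix_conj_transpose hA)]; exact one_pos) hv hA0 hv0

lemma mulVec_zero_pos_iff {d : ℕ} [NeZero d] {A : Matrix (Fin d) (Fin d) ℝ}
    (hA : Aᵀ * minkMatrix d * A = minkMatrix d) (hA0 : 0 < A 0 0) {v : Fin d → ℝ}
    (hv : 0 < minkForm d v) : 0 < (A *ᵥ v) 0 ↔ 0 < v 0 := by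
  refine ⟨fun h => ?_, mulVec_zero_pos hA hA0 hv⟩
  set B := minkMatrix d * Aᵀ * minkMatrix d with hB
  have hBA : B * A = 1 := by
    rw [hB, mul_assoc, mul_assoc, ← mul_assoc Aᵀ, hA, minkMatrix_mul_self]
  have hBL : Bᵀ * minkMatrix d * B = minkMatrix d := by
    have hc := minkMatrix_conj_transpose hA
    have h1 : Bᵀ * minkMatrix d * B
        = minkMatrix d * (A * (minkMatrix d * minkMatrix d * minkMatrix d) * Aᵀ)
          * minkMatrix d := by
      simp only [hB, Matrix.transpose_mul, Matrix.transpose_transpose, minkMatrix_transpose,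
        mul_assoc]
    rw [h1, minkMatrix_mul_self, one_mul, hc, minkMatrix_mul_self, one_mul]
  have hB0 : 0 < B 0 0 := by
    simpa [hB, minkMatrix, Matrix.mul_diagonal, Matrix.diagonal_mul] using hA0
  have := mulVec_zero_pos hBL hB0 (by rwa [minkForm_mulVec hA]) h
  rwa [Matrix.mulVec_mulVec, hBA, Matrix.one_mulVec] at this

lemma jmass_eq (d : ℕ) [NeZero d] (m γ : ℝ) (x : EuclideanSpace ℝ (Fin d)) :
    jmass d m γ x = if 0 < x 0 ∧ m ^ 2 < minkForm d x then
      (minkForm d x - m ^ 2) ^ (-γ) else 0 := by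
  have hiff : Real.sqrt ((∑ i ∈ Finset.univ.erase 0, x i ^ 2) + m ^ 2) < x 0 ↔
      0 < x 0 ∧ m ^ 2 < minkForm d x := by
    constructor
    · intro h
      have h0 := (Real.sqrt_nonneg _).trans_lt h
      have := (Real.sqrt_lt' h0).mp h
      exact ⟨h0, by simp only [minkForm]; linarith⟩
    · rintro ⟨h0, h⟩
      simp only [minkForm] at h
      exact (Real.sqrt_lt' h0).mpr (by linarith)
  simp only [jmass, hiff, minkForm, sub_sub]

lemma jmass_matAct {d : ℕ} [NeZero d] (m γ : ℝ) {A : Matrix (Fin d) (Fin d) ℝ}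
    (hA : Aᵀ * minkMatrix d * A = minkMatrix d) (hA0 : 0 < A 0 0)
    (x : EuclideanSpace ℝ (Fin d)) : jmass d m γ (matAct d A x) = jmass d m γ x := by
  have hQ : minkForm d (matAct d A x) = minkForm d x := minkForm_mulVec hA _
  have hiff : (0 < matAct d A x 0 ∧ m ^ 2 < minkForm d x) ↔
      (0 < x 0 ∧ m ^ 2 < minkForm d x) :=
    and_congr_left fun h => mulVec_zero_pos_iff hA hA0 ((sq_nonneg m).trans_lt h)
  simp only [jmass_eq, hQ, hiff]

lemma inner_matAct (d : ℕ) (A : Matrix (Fin d) (Fin d) ℝ) (x y : EuclideanSpace ℝ (Fin d)) :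
    inner ℝ (matAct d A x) y = inner ℝ x (matAct d Aᵀ y) := by
  have h (u v : EuclideanSpace ℝ (Fin d)) :
      inner ℝ u v = (u : Fin d → ℝ) ⬝ᵥ (v : Fin d → ℝ) := by
    simp [PiLp.inner_apply, dotProduct, mul_comm]
  rw [h, h]
  change (A *ᵥ (x : Fin d → ℝ)) ⬝ᵥ _ = _ ⬝ᵥ (Aᵀ *ᵥ (y : Fin d → ℝ))
  rw [Matrix.dotProduct_mulVec, Matrix.vecMul_transpose]

lemma matAct_eq_toEuclideanLin (d : ℕ) (A : Matrix (Fin d) (Fin d) ℝ) :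
    matAct d A = Matrix.toEuclideanLin A := rfl

/-- A unimodular linear change of variables preserves every Bochner integral. -/
lemma integral_comp_matAct {E : Type*} [NormedAddCommGroup E] [NormedSpace ℝ E] {d : ℕ}
    {A : Matrix (Fin d) (Fin d) ℝ} (hA : A.det = 1) (F : EuclideanSpace ℝ (Fin d) → E) :
    ∫ x, F (matAct d A x) = ∫ x, F x := by
  have hdet : LinearMap.det (Matrix.toEuclideanLin A) = 1 := by
    rw [Matrix.toEuclideanLin_eq_toLin_orthonormal, LinearMap.det_toLin, hA]
  have hunit : IsUnit (LinearMap.det (Matrix.toEuclideanLin A)) := by simp [hdet]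
  have hemb : MeasurableEmbedding (Matrix.toEuclideanLin A) :=
    (LinearEquiv.ofIsUnitDet (f := Matrix.toEuclideanLin A)
      (v := (EuclideanSpace.basisFun (Fin d) ℝ).toBasis)
      (v' := (EuclideanSpace.basisFun (Fin d) ℝ).toBasis)
      (by simpa using hunit)).toContinuousLinearEquiv.toHomeomorph.measurableEmbedding
  have hmap := Measure.map_linearMap_addHaar_eq_smul_addHaar
    (volume : Measure (EuclideanSpace ℝ (Fin d))) hunit.ne_zero
  rw [hdet] at hmap
  simp only [inv_one, abs_one, ENNReal.ofReal_one, one_smul] at hmap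
  rw [matAct_eq_toEuclideanLin, ← hemb.integral_map, hmap]

/-- The Fourier transform of `y ↦ f (a + Λ y)` at the frequency `Λᵀ η`. -/
lemma fourier_comp_affine {d : ℕ} {Λ : Matrix (Fin d) (Fin d) ℝ} (hdet : Λ.det = 1)
    (a : EuclideanSpace ℝ (Fin d)) (f : EuclideanSpace ℝ (Fin d) → ℂ)
    (η : EuclideanSpace ℝ (Fin d)) :
    𝓕 (fun y => f (a + matAct d Λ y)) (matAct d Λᵀ η)
      = Real.fourierChar (inner ℝ a η) • 𝓕 f η := by
  simp only [Real.fourier_eq]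
  simp only [← inner_matAct]
  rw [integral_comp_matAct hdet (fun z => Real.fourierChar (-inner ℝ z η) • f (a + z)),
    ← integral_add_left_eq_self (fun z => Real.fourierChar (-inner ℝ z η) • f z) a]
  simp only [Circle.smul_def]
  rw [← integral_smul]
  refine integral_congr_ae (.of_forall fun z => ?_)
  simp only [smul_smul, ← Circle.coe_mul, ← AddChar.map_add_eq_mul, inner_add_left]
  congr 3
  ring

/-- Poincaré covariance of `J`. -/
lemma Jop_comp_affine {d : ℕ} [NeZero d] (m γ : ℝ) {Λ : Matrix (Fin d) (Fin d) ℝ}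
    (hΛ : Λᵀ * minkMatrix d * Λ = minkMatrix d) (hdet : Λ.det = 1) (hor : 0 < Λ 0 0)
    (a : EuclideanSpace ℝ (Fin d)) (f : EuclideanSpace ℝ (Fin d) → ℂ)
    (x : EuclideanSpace ℝ (Fin d)) :
    Jop d m γ (fun y => f (a + matAct d Λ y)) x = Jop d m γ f (a + matAct d Λ x) := by
  have hT : Λᵀᵀ * minkMatrix d * Λᵀ = minkMatrix d := by
    rw [Matrix.transpose_transpose]
    exact minkMatrix_conj_transpose hΛ
  have hj := jmass_matAct m γ hT hor
  simp only [Jop, Real.fourierInv_eq]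
  rw [← integral_comp_matAct (A := Λᵀ) (by rw [Matrix.det_transpose, hdet])]
  refine integral_congr_ae (.of_forall fun η => ?_)
  simp only [hj, fourier_comp_affine hdet]
  rw [inner_matAct, Matrix.transpose_transpose, inner_add_right, real_inner_comm η a,
    AddChar.map_add_eq_mul]
  simp only [Circle.smul_def, Circle.coe_mul, smul_eq_mul]
  ring

theorem stmt_5 (d : ℕ) [NeZero d] (hd : 2 ≤ d) (m γ : ℝ) (hm : 0 < m)
    (hγ : γ ∈ Set.Ioo (0 : ℝ) (1 / 2))
    (f g : SchwartzMap (EuclideanSpace ℝ (Fin d)) ℂ)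
    (Λ : Matrix (Fin d) (Fin d) ℝ)
    (hΛ : Λ.transpose * minkMatrix d * Λ = minkMatrix d)
    (hdet : Λ.det = 1) (hor : 0 < Λ 0 0) (a : EuclideanSpace ℝ (Fin d)) :
    (∫ x : EuclideanSpace ℝ (Fin d),
        ‖Jop d m γ (fun y => f (a + matAct d Λ y)) x +
          (starRingEnd ℂ) (Jop d m γ (fun y => g (a + matAct d Λ y)) x)‖ ^ 2)
      =
    ∫ x : EuclideanSpace ℝ (Fin d),
        ‖Jop d m γ (⇑f) x + (starRingEnd ℂ) (Jop d m γ (⇑g) x)‖ ^ 2 := by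
  simp only [Jop_comp_affine m γ hΛ hdet hor a]
  rw [integral_comp_matAct hdet (fun z => ‖Jop d m γ (⇑f) (a + z) +
      (starRingEnd ℂ) (Jop d m γ (⇑g) (a + z))‖ ^ 2),
    integral_add_left_eq_self (fun z => ‖Jop d m γ (⇑f) z +
      (starRingEnd ℂ) (Jop d m γ (⇑g) z)‖ ^ 2)]
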